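/- Let Q be a lower-connected poset (every pair of elements of Q has a lower bound in Q), and let D, D′ ⊆ Q be downsets with D′ nonempty. Then Hom_Q(k[D], k[D′]) is a one-dimensional k-vector space if D′ ⊆ D, and is zero otherwise. -/

import Mathlib

/-- The component of the indicator module `k[S]` in degree `q`: the field `k`
(as the full submodule of itself) if `q ∈ S`, and `0` otherwise. -/
noncomputable def cmpt (k : Type) [Field k] {Q : Type} (S : Set Q) (q : Q) : Submodule k k :=
  haveI := Classical.dec (q ∈ S)
  if q ∈ S then ⊤ else ⊥

/-- The structure map of the indicator module `k[S]` for `q ≤ q'`: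
the identity of `k` when `q, q' ∈ S`, and `0` otherwise. -/
noncomputable def stMap (k : Type) [Field k] {Q : Type} [PartialOrder Q] (S : Set Q)
    {q q' : Q} (h : q ≤ q') : ↥(cmpt k S q) →ₗ[k] ↥(cmpt k S q') :=
  haveI := Classical.dec (q ∈ S ∧ q' ∈ S)
  if hq : q ∈ S ∧ q' ∈ S then
    Submodule.inclusion (by simp [cmpt, hq.1, hq.2])
  else 0

/-- The space of `Q`-module homomorphisms `k[S] → k[T]` between indicator modules:
families of linear maps in each degree commuting with the structure maps. -/
noncomputable def HomQ (k : Type) [Field k] {Q : Type} [PartialOrder Q] (S T : Set Q) :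
    Submodule k (∀ q : Q, ↥(cmpt k S q) →ₗ[k] ↥(cmpt k T q)) where
  carrier := {φ | ∀ (q q' : Q) (h : q ≤ q'), stMap k T h ∘ₗ φ q = φ q' ∘ₗ stMap k S h}
  add_mem' := by
    intro a b ha hb
    simp only [Set.mem_setOf_eq] at ha hb ⊢
    intro q q' h
    ext x
    have ha' := congrArg (fun g => g x) (ha q q' h)
    have hb' := congrArg (fun g => g x) (hb q q' h)
    simp only [LinearMap.comp_apply] at ha' hb' ⊢
    simp only [Pi.add_apply, LinearMap.add_apply, map_add, ha', hb']
  zero_mem' := by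
    simp only [Set.mem_setOf_eq]
    intro q q' h
    ext x
    simp
  smul_mem' := by
    intro c a ha
    simp only [Set.mem_setOf_eq] at ha ⊢
    intro q q' h
    ext x
    have ha' := congrArg (fun g => g x) (ha q q' h)
    simp only [LinearMap.comp_apply] at ha' ⊢
    simp only [Pi.smul_apply, LinearMap.smul_apply, map_smul, ha']

/-- The scalar by which a homomorphism of indicator modules acts in degree `q`. -/
noncomputable def scl {k : Type} [Field k] {Q : Type} {S T : Set Q}
    (φ : ∀ q : Q, ↥(cmpt k S q) →ₗ[k] ↥(cmpt k T q)) (q : Q) (hq : q ∈ S) : k :=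
  (φ q ⟨1, by simp [cmpt, hq]⟩ : ↥(cmpt k T q)).1

/-- The set of connected components of a subset `S` of a poset: the quotient of `S`
by the equivalence relation generated by comparability (zigzag paths within `S`). -/
def Pi0 {Q : Type} [PartialOrder Q] (S : Set Q) : Type :=
  Quot (fun a b : S => (a : Q) ≤ (b : Q))

theorem coe_eq_zero_of_notMem {k : Type} [Field k] {Q : Type} {S : Set Q} {q : Q} (hq : q ∉ S)
    (x : ↥(cmpt k S q)) : (x : k) = 0 := by
  have hx := x.2
  simpa only [cmpt, if_neg hq, Submodule.mem_bot] using hx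

theorem mem_cmpt_of_mem {k : Type} [Field k] {Q : Type} {S : Set Q} {q : Q} (hq : q ∈ S)
    (x : k) : x ∈ cmpt k S q := by
  simp [cmpt, hq]

theorem coe_stMap_of_mem {k : Type} [Field k] {Q : Type} [PartialOrder Q] {S : Set Q}
    {q q' : Q} (h : q ≤ q') (hq : q ∈ S) (hq' : q' ∈ S) (x : ↥(cmpt k S q)) :
    (stMap k S h x : k) = x := by
  rw [stMap, dif_pos ⟨hq, hq'⟩, Submodule.coe_inclusion]

theorem coe_apply_eq_mul_scl {k : Type} [Field k] {Q : Type} {S T : Set Q}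
    (φ : ∀ q : Q, ↥(cmpt k S q) →ₗ[k] ↥(cmpt k T q)) {q : Q} (hq : q ∈ S)
    (x : ↥(cmpt k S q)) : (φ q x : k) = x * scl φ q hq := by
  have hx : x = (x : k) • (⟨1, mem_cmpt_of_mem hq 1⟩ : ↥(cmpt k S q)) :=
    Subtype.ext (by simp)
  conv_lhs => rw [hx, map_smul]
  rfl

theorem family_ext_scl {k : Type} [Field k] {Q : Type} {S T : Set Q}
    {φ ψ : ∀ q : Q, ↥(cmpt k S q) →ₗ[k] ↥(cmpt k T q)}
    (h : ∀ (q : Q) (hq : q ∈ S), q ∈ T → scl φ q hq = scl ψ q hq) : φ = ψ := by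
  funext q
  refine LinearMap.ext fun x => Subtype.ext ?_
  by_cases hT : q ∈ T
  · by_cases hS : q ∈ S
    · rw [coe_apply_eq_mul_scl φ hS, coe_apply_eq_mul_scl ψ hS, h q hS hT]
    · have hx : x = 0 := Subtype.ext (coe_eq_zero_of_notMem hS x)
      rw [hx, map_zero, map_zero]
  · rw [coe_eq_zero_of_notMem hT, coe_eq_zero_of_notMem hT]

theorem scl_eq_of_le {k : Type} [Field k] {Q : Type} [PartialOrder Q] {S T : Set Q}
    {φ : ∀ q : Q, ↥(cmpt k S q) →ₗ[k] ↥(cmpt k T q)} (hφ : φ ∈ HomQ k S T)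
    {q q' : Q} (h : q ≤ q') (hq : q ∈ S) (hq' : q' ∈ S) (hqT : q ∈ T) (hqT' : q' ∈ T) :
    scl φ q hq = scl φ q' hq' := by
  have key := congrArg Subtype.val
    (LinearMap.congr_fun (hφ q q' h) ⟨1, mem_cmpt_of_mem hq 1⟩)
  rw [LinearMap.comp_apply, LinearMap.comp_apply, coe_stMap_of_mem h hqT hqT',
    coe_apply_eq_mul_scl φ hq, coe_apply_eq_mul_scl φ hq', coe_stMap_of_mem h hq hq'] at key
  simpa using key

theorem scl_eq_zero_of_le {k : Type} [Field k] {Q : Type} [PartialOrder Q] {S T : Set Q}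
    {φ : ∀ q : Q, ↥(cmpt k S q) →ₗ[k] ↥(cmpt k T q)} (hφ : φ ∈ HomQ k S T)
    {q q' : Q} (h : q ≤ q') (hq : q ∈ S) (hq' : q' ∉ S) (hqT : q ∈ T) (hqT' : q' ∈ T) :
    scl φ q hq = 0 := by
  have key := congrArg Subtype.val
    (LinearMap.congr_fun (hφ q q' h) ⟨1, mem_cmpt_of_mem hq 1⟩)
  have hzero : stMap k S h ⟨1, mem_cmpt_of_mem hq 1⟩ = 0 :=
    Subtype.ext (coe_eq_zero_of_notMem hq' _)
  rw [LinearMap.comp_apply, LinearMap.comp_apply, coe_stMap_of_mem h hqT hqT',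
    coe_apply_eq_mul_scl φ hq, hzero, map_zero] at key
  simpa using key

open Classical in
/-- The family `k[S] → k[T]` that is the identity of `k` in the degrees of `S ∩ T`
and zero elsewhere. -/
noncomputable def canonicalFamily (k : Type) [Field k] {Q : Type} (S T : Set Q) (q : Q) :
    ↥(cmpt k S q) →ₗ[k] ↥(cmpt k T q) :=
  if hq : q ∈ T then
    (cmpt k S q).subtype.codRestrict (cmpt k T q) fun _ => mem_cmpt_of_mem (k := k) hq _
  else 0

theorem coe_canonicalFamily_of_mem {k : Type} [Field k] {Q : Type} {S T : Set Q} {q : Q}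
    (hq : q ∈ T) (x : ↥(cmpt k S q)) : (canonicalFamily k S T q x : k) = x := by
  rw [canonicalFamily, dif_pos hq]
  rfl

theorem canonicalFamily_mem_homQ {k : Type} [Field k] {Q : Type} [PartialOrder Q] {S T : Set Q}
    (hT : IsLowerSet T) (hTS : T ⊆ S) : canonicalFamily k S T ∈ HomQ k S T := by
  intro q q' h
  refine LinearMap.ext fun x => Subtype.ext ?_
  rw [LinearMap.comp_apply, LinearMap.comp_apply]
  by_cases hq' : q' ∈ T
  · have hq : q ∈ T := hT h hq'
    rw [coe_stMap_of_mem h hq hq', coe_canonicalFamily_of_mem hq,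
      coe_canonicalFamily_of_mem hq', coe_stMap_of_mem h (hTS hq) (hTS hq')]
  · exact (coe_eq_zero_of_notMem hq' _).trans (coe_eq_zero_of_notMem hq' _).symm

/-- Let `Q` be a lower-connected poset (every pair of elements has a
lower bound) and let `D, D'` be downsets of `Q` with `D'` nonempty.  Then
`Hom_Q(k[D], k[D'])` is one-dimensional if `D' ⊆ D` and is zero otherwise. -/
theorem hom_downset_downset_lower_connected (k : Type) [Field k] (Q : Type) [PartialOrder Q]
    (hQ : ∀ a b : Q, ∃ c : Q, c ≤ a ∧ c ≤ b)
    (D D' : Set Q) (hD : IsLowerSet D) (hD' : IsLowerSet D') (hne : D'.Nonempty) :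
    (D' ⊆ D → Module.rank k ↥(HomQ k D D') = 1) ∧
    (¬ D' ⊆ D → HomQ k D D' = ⊥) := by
  constructor
  · intro hsub
    obtain ⟨p, hp⟩ := hne
    have hcan (q : Q) (hq : q ∈ D) (hq' : q ∈ D') : scl (canonicalFamily k D D') q hq = 1 :=
      coe_canonicalFamily_of_mem hq' _
    refine rank_eq_one (⟨canonicalFamily k D D', canonicalFamily_mem_homQ hD' hsub⟩ :
      ↥(HomQ k D D')) ?_ ?_
    · intro h0
      have h1 := hcan p (hsub hp) hp
      rw [show canonicalFamily k D D' = 0 from congrArg Subtype.val h0] at h1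
      exact zero_ne_one h1
    · rintro ⟨φ, hφ⟩
      refine ⟨scl φ p (hsub hp), Subtype.ext (family_ext_scl fun q hq hq' => ?_)⟩
      obtain ⟨c, hcp, hcq⟩ := hQ p q
      have hc' : c ∈ D' := hD' hcp hp
      calc scl φ p (hsub hp) * scl (canonicalFamily k D D') q hq
          = scl φ p (hsub hp) := by rw [hcan q hq hq', mul_one]
        _ = scl φ c (hsub hc') := (scl_eq_of_le hφ hcp _ _ hc' hp).symm
        _ = scl φ q hq := scl_eq_of_le hφ hcq _ _ hc' hq'
  · intro hsub
    obtain ⟨p, hp, hpD⟩ := Set.not_subset.mp hsub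
    refine (Submodule.eq_bot_iff _).mpr fun φ hφ => family_ext_scl fun q hq hq' => ?_
    obtain ⟨c, hcp, hcq⟩ := hQ p q
    have hc : c ∈ D := hD hcq hq
    have hc' : c ∈ D' := hD' hcp hp
    calc scl φ q hq = scl φ c hc := (scl_eq_of_le hφ hcq hc hq hc' hq').symm
      _ = 0 := scl_eq_zero_of_le hφ hcp hc hpD hc' hp
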